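/- For every integer d ≥ 3 and every c > 0 there exists a constant C ≥ 1 such that for all L ≥ C, all reals θ, ρ with 2 ≤ θ ≤ C^{-1}ρ and C·ρ ≤ L, and every ball A ⊂ ℝ^d of radius L, the number of points x ∈ A ∩ ℤ^d for which there exist a ball B ⊂ ℝ^d of radius L and a real α with #{ y ∈ B ∩ ℤ^d : |x·y − α| ≤ ρ } ≥ c·L^{d−1}θ^{−1}, is at most C·( ρ^d + L^{d−2}(log L)^C ρ² θ² ). -/

import Mathlib

open scoped RealInnerProductSpace BigOperators

noncomputable section

/-- The integer lattice `ℤ^d` inside `ℝ^d`. -/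
def intLattice (d : ℕ) : Set (EuclideanSpace ℝ (Fin d)) :=
  {x | ∀ i, ∃ m : ℤ, x i = (m : ℝ)}

/-- A finite set which injects into integers with pairwise differences at most `W` has at most
`W + 1` elements. -/
theorem card_le_of_injOn_int {β : Type*} (T : Finset β) (g : β → ℤ) {W : ℝ} (hW : 0 ≤ W)
    (hg : Set.InjOn g T) (h : ∀ a ∈ T, ∀ b ∈ T, (g a : ℝ) - g b ≤ W) :
    (T.card : ℝ) ≤ W + 1 := by
  classical
  rcases T.eq_empty_or_nonempty with rfl | hT
  · simp; linarith
  obtain ⟨b, hb, hmin⟩ := T.exists_min_image g hT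
  have hsub : T.image g ⊆ Finset.Icc (g b) (g b + ⌊W⌋) := by
    intro z hz
    obtain ⟨a, ha, rfl⟩ := Finset.mem_image.1 hz
    have h1 : g a - g b ≤ ⌊W⌋ := Int.le_floor.2 (by push_cast; exact h a ha b hb)
    exact Finset.mem_Icc.2 ⟨hmin a ha, by linarith⟩
  have h2 := Finset.card_le_card hsub
  rw [Finset.card_image_of_injOn hg, Int.card_Icc] at h2
  have h3 : (T.card : ℤ) ≤ ⌊W⌋ + 1 := by
    have := Int.floor_nonneg.2 hW
    omega
  have h4 : (T.card : ℝ) ≤ ⌊W⌋ + 1 := by exact_mod_cast h3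
  linarith [Int.floor_le W]

/-- Many integers in a short interval contain two that are close to each other. -/
theorem exists_sub_lt_of_card {β : Type*} (T : Finset β) (g : β → ℤ) {W : ℝ} (hW : 0 ≤ W)
    (hg : Set.InjOn g T) (h : ∀ a ∈ T, ∀ b ∈ T, (g a : ℝ) - g b ≤ W) {Q : ℕ} (hQ : 0 < Q)
    (hcard : W / Q + 2 < T.card) :
    ∃ a ∈ T, ∃ b ∈ T, 0 < g a - g b ∧ g a - g b < Q := by
  by_contra! hno
  have hQ' : (0 : ℤ) < Q := by exact_mod_cast hQ
  have hQr : (0 : ℝ) < Q := by exact_mod_cast hQ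
  have key : (T.card : ℝ) ≤ (W / Q + 1) + 1 := by
    refine card_le_of_injOn_int T (fun a => g a / (Q : ℤ)) (by positivity) ?_ ?_
    · intro a ha b hb hab
      have ha1 := Int.emod_add_mul_ediv (g a) Q
      have hb1 := Int.emod_add_mul_ediv (g b) Q
      have ha2 := Int.emod_nonneg (g a) hQ'.ne'
      have hb2 := Int.emod_nonneg (g b) hQ'.ne'
      have ha3 := Int.emod_lt_of_pos (g a) hQ'
      have hb3 := Int.emod_lt_of_pos (g b) hQ'
      simp only at hab
      rw [hab] at ha1
      refine hg ha hb (le_antisymm ?_ ?_)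
      · by_contra! hlt
        have := hno a ha b hb (by linarith)
        linarith
      · by_contra! hlt
        have := hno b hb a ha (by linarith)
        linarith
    · intro a ha b hb
      have ha1 := Int.emod_add_mul_ediv (g a) Q
      have hb1 := Int.emod_add_mul_ediv (g b) Q
      have ha2 := Int.emod_nonneg (g a) hQ'.ne'
      have hb3 := Int.emod_lt_of_pos (g b) hQ'
      have h1 : (Q : ℤ) * (g a / Q - g b / Q) ≤ g a - g b + Q := by linarith
      have h2 : (Q : ℝ) * (((g a / (Q : ℤ) : ℤ) : ℝ) - ((g b / (Q : ℤ) : ℤ) : ℝ))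
          ≤ g a - g b + Q := by
        exact_mod_cast h1
      have h3 := h a ha b hb
      have h4 : W / Q + 1 = (W + Q) / Q := by field_simp
      rw [h4, le_div_iff₀ hQr]
      linarith
  linarith

/-- Counting lattice points of a planar strip along lines in a primitive direction `(q, p)`. -/
theorem card_le_of_primitive (T : Finset (ℤ × ℤ)) {X Z q p : ℤ} {L ρ : ℝ} (hL : 0 ≤ L)
    (hρ : 0 ≤ ρ) (hq : 0 < q) (hpq : IsCoprime q p) (hr : q * X + p * Z ≠ 0) (hZ : Z ≠ 0)
    (h1 : ∀ a ∈ T, ∀ b ∈ T, |((a.1 - b.1 : ℤ) : ℝ)| ≤ 2 * L)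
    (h2 : ∀ a ∈ T, ∀ b ∈ T, |((X * (a.1 - b.1) + Z * (a.2 - b.2) : ℤ) : ℝ)| ≤ 2 * ρ) :
    (T.card : ℝ) ≤ (2 * ρ / |((q * X + p * Z : ℤ) : ℝ)| + 1) *
      ((2 * q * ρ + 2 * L * |((q * X + p * Z : ℤ) : ℝ)|) / |(Z : ℝ)| + 1) := by
  classical
  set r : ℤ := q * X + p * Z with hrdef
  have hr' : 0 < |(r : ℝ)| := abs_pos.2 (by exact_mod_cast hr)
  have hZ' : 0 < |(Z : ℝ)| := abs_pos.2 (by exact_mod_cast hZ)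
  have hq' : (0 : ℝ) < q := by exact_mod_cast hq
  set f : ℤ × ℤ → ℤ := fun a => q * a.2 - p * a.1 with hf
  have himage : ((T.image f).card : ℝ) ≤ (2 * q * ρ + 2 * L * |(r : ℝ)|) / |(Z : ℝ)| + 1 := by
    refine card_le_of_injOn_int _ id (by positivity) (Set.injOn_id _) ?_
    intro z hz w hw
    obtain ⟨a, ha, rfl⟩ := Finset.mem_image.1 hz
    obtain ⟨b, hb, rfl⟩ := Finset.mem_image.1 hw
    rw [le_div_iff₀ hZ']
    have e : Z * (f a - f b) =
        q * (X * (a.1 - b.1) + Z * (a.2 - b.2)) - r * (a.1 - b.1) := by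
      simp only [hf, hrdef]; ring
    have e' : (Z : ℝ) * ((f a : ℝ) - f b) =
        q * ((X * (a.1 - b.1) + Z * (a.2 - b.2) : ℤ) : ℝ) - r * ((a.1 - b.1 : ℤ) : ℝ) := by
      exact_mod_cast e
    calc ((f a : ℝ) - f b) * |(Z : ℝ)|
        ≤ |(f a : ℝ) - f b| * |(Z : ℝ)| := by
          gcongr
          exact le_abs_self _
      _ = |(Z : ℝ) * ((f a : ℝ) - f b)| := by rw [abs_mul, mul_comm]
      _ ≤ |q * ((X * (a.1 - b.1) + Z * (a.2 - b.2) : ℤ) : ℝ)| +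
            |r * ((a.1 - b.1 : ℤ) : ℝ)| := by rw [e']; exact abs_sub _ _
      _ ≤ q * (2 * ρ) + |(r : ℝ)| * (2 * L) := by
          rw [abs_mul, abs_mul, abs_of_pos hq']
          gcongr
          · exact h2 a ha b hb
          · exact h1 a ha b hb
      _ = _ := by ring
  have hfib : ∀ z ∈ T.image f, ((T.filter fun a => f a = z).card : ℝ) ≤
      2 * ρ / |(r : ℝ)| + 1 := by
    intro z hz
    obtain ⟨o, ho, rfl⟩ := Finset.mem_image.1 hz
    have hk : ∀ a ∈ T.filter (fun a => f a = f o),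
        ∃ k : ℤ, a.1 - o.1 = q * k ∧ a.2 - o.2 = p * k := by
      intro a ha
      have hfa : q * a.2 - p * a.1 = q * o.2 - p * o.1 := (Finset.mem_filter.1 ha).2
      have hdvd : q ∣ p * (a.1 - o.1) := ⟨a.2 - o.2, by linarith⟩
      obtain ⟨k, hk⟩ := hpq.dvd_of_dvd_mul_left hdvd
      refine ⟨k, hk, mul_left_cancel₀ hq.ne' ?_⟩
      calc q * (a.2 - o.2) = p * (a.1 - o.1) := by linarith
        _ = q * (p * k) := by rw [hk]; ring
    choose! k hk1 hk2 using hk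
    refine card_le_of_injOn_int _ k (by positivity) ?_ ?_
    · intro a ha b hb hab
      have a1 := hk1 a ha
      have b1 := hk1 b hb
      have a2 := hk2 a ha
      have b2 := hk2 b hb
      rw [hab] at a1 a2
      exact Prod.ext (by linarith) (by linarith)
    · intro a ha b hb
      rw [le_div_iff₀ hr']
      have e : r * (k a - k b) = X * (a.1 - b.1) + Z * (a.2 - b.2) := by
        have a1 := hk1 a ha
        have b1 := hk1 b hb
        have a2 := hk2 a ha
        have b2 := hk2 b hb
        simp only [hrdef]
        linear_combination X * (b1 - a1) + Z * (b2 - a2)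
      have e' : (r : ℝ) * ((k a : ℝ) - k b) =
          ((X * (a.1 - b.1) + Z * (a.2 - b.2) : ℤ) : ℝ) := by exact_mod_cast e
      calc ((k a : ℝ) - k b) * |(r : ℝ)| ≤ |(k a : ℝ) - k b| * |(r : ℝ)| := by
            gcongr; exact le_abs_self _
        _ = |(r : ℝ) * ((k a : ℝ) - k b)| := by rw [abs_mul, mul_comm]
        _ ≤ 2 * ρ := by
            rw [e']
            exact h2 a (Finset.mem_filter.1 ha).1 b (Finset.mem_filter.1 hb).1
  calc (T.card : ℝ) = ∑ z ∈ T.image f, ((T.filter fun a => f a = z).card : ℝ) := by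
        exact_mod_cast Finset.card_eq_sum_card_image f T
    _ ≤ ∑ _z ∈ T.image f, (2 * ρ / |(r : ℝ)| + 1) := Finset.sum_le_sum hfib
    _ = (2 * ρ / |(r : ℝ)| + 1) * (T.image f).card := by
        rw [Finset.sum_const, nsmul_eq_mul, mul_comm]
    _ ≤ _ := by gcongr

/-- A planar strip with many lattice points, compared to its area, is parallel to a short lattice
vector. -/
theorem exists_mul_add_mul_eq_zero (T : Finset (ℤ × ℤ)) {X Z : ℤ} {L θ ρ κ : ℝ} {Q : ℕ}
    (hκ : 0 < κ) (hθ : 2 ≤ θ) (hρ : 1 ≤ ρ) (hL : 4 * θ < κ * L) (hρL : 10 * (ρ * θ) ≤ κ * L)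
    (hQ1 : 4 * θ ≤ κ * Q) (hQ2 : 8 * (Q * ρ) ≤ |(Z : ℝ)|) (hZ : 32 * (ρ * θ) ≤ κ * |(Z : ℝ)|)
    (hZρ : 2 * ρ < |(Z : ℝ)|) (hcard : κ * L / θ ≤ T.card)
    (h1 : ∀ a ∈ T, ∀ b ∈ T, |((a.1 - b.1 : ℤ) : ℝ)| ≤ 2 * L)
    (h2 : ∀ a ∈ T, ∀ b ∈ T, |((X * (a.1 - b.1) + Z * (a.2 - b.2) : ℤ) : ℝ)| ≤ 2 * ρ) :
    ∃ q p : ℤ, 0 < q ∧ q ≤ Q ∧ q * X + p * Z = 0 := by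
  have hθ0 : 0 < θ := by linarith
  have hL0 : 0 < L := by
    by_contra! hneg
    nlinarith
  have hQ0 : (0 : ℝ) < Q := by
    by_contra! hneg
    nlinarith
  have hZ0 : 0 < |(Z : ℝ)| := by linarith
  have hZne : Z ≠ 0 := by rintro rfl; simp at hZ0
  have hinj : Set.InjOn (fun a : ℤ × ℤ => a.1) T := by
    intro a ha b hb hab
    simp only at hab
    have h := h2 a ha b hb
    rw [hab, sub_self, mul_zero, zero_add] at h
    push_cast at h
    rw [abs_mul] at h
    by_contra hne
    have hne2 : a.2 - b.2 ≠ 0 := fun h0 => hne (Prod.ext hab (by linarith))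
    have h3 : (1 : ℝ) ≤ |(a.2 : ℝ) - b.2| := by exact_mod_cast Int.one_le_abs hne2
    nlinarith
  have hclose : 2 * L / Q + 2 < T.card := by
    refine lt_of_lt_of_le ?_ hcard
    have e1 : 2 * L / Q ≤ κ * L / (2 * θ) := by
      rw [div_le_div_iff₀ hQ0 (by positivity)]
      nlinarith
    have e2 : 2 < κ * L / (2 * θ) := by
      rw [lt_div_iff₀ (by positivity)]; linarith
    have e3 : κ * L / θ = κ * L / (2 * θ) + κ * L / (2 * θ) := by field_simp; ring
    linarith
  obtain ⟨a, ha, b, hb, hpos, hlt⟩ := exists_sub_lt_of_card T (fun a => a.1) (by positivity) hinj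
    (fun a ha b hb => by
      have := (le_abs_self _).trans (h1 a ha b hb)
      push_cast at this
      exact this) (by exact_mod_cast hQ0) hclose
  have hs := h2 a ha b hb
  set u := a.1 - b.1 with hu
  set v := a.2 - b.2 with hv
  obtain ⟨g, q, p, hg0, hcop, hgu, hgv⟩ : ∃ g q p : ℤ, 0 < g ∧ IsCoprime q p ∧
      u = g * q ∧ v = g * p := by
    have hgpos : 0 < Int.gcd u v := Int.gcd_pos_of_ne_zero_left _ hpos.ne'
    obtain ⟨q, p, hc, e1, e2⟩ := Int.exists_gcd_one hgpos
    exact ⟨Int.gcd u v, q, p, by exact_mod_cast hgpos, Int.isCoprime_iff_gcd_eq_one.2 hc,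
      by rw [mul_comm]; exact e1, by rw [mul_comm]; exact e2⟩
  have hq : 0 < q := by
    rw [hgu] at hpos
    exact (pos_iff_pos_of_mul_pos hpos).1 hg0
  have hqQ : q ≤ Q := by nlinarith
  refine ⟨q, p, hq, hqQ, ?_⟩
  by_contra hr
  have hbound := card_le_of_primitive T hL0.le (by linarith : (0 : ℝ) ≤ ρ) hq hcop hr hZne h1 h2
  have hr1 : (1 : ℝ) ≤ |((q * X + p * Z : ℤ) : ℝ)| := by exact_mod_cast Int.one_le_abs hr
  have hr2 : |((q * X + p * Z : ℤ) : ℝ)| ≤ 2 * ρ := by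
    refine le_trans ?_ hs
    have e : X * u + Z * v = g * (q * X + p * Z) := by rw [hgu, hgv]; ring
    rw [e, Int.cast_mul, abs_mul]
    have : (1 : ℝ) ≤ |(g : ℝ)| := by exact_mod_cast Int.one_le_abs hg0.ne'
    exact le_mul_of_one_le_left (abs_nonneg _) this
  set R := |((q * X + p * Z : ℤ) : ℝ)|
  set z := |(Z : ℝ)|
  have hR0 : 0 < R := by linarith
  have hqQ' : (q : ℝ) ≤ Q := by exact_mod_cast hqQ
  have hq' : (0 : ℝ) < q := by exact_mod_cast hq
  have b1 : 2 * ρ / R + 1 ≤ 4 * ρ / R := by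
    rw [div_add_one hR0.ne']
    gcongr
    linarith
  have b2 : 4 * ρ / R * ((2 * q * ρ + 2 * L * R) / z + 1) =
      ρ / R * (8 * (q * ρ) / z) + 8 * (L * ρ / z) + 4 * (ρ / R) := by
    field_simp
    ring
  have b3 : 8 * (q * ρ) / z ≤ 1 := by
    rw [div_le_one hZ0]
    nlinarith
  have b4 : ρ / R ≤ ρ := div_le_self (by linarith) hr1
  have b5 : L * ρ / z ≤ κ * L / (32 * θ) := by
    rw [div_le_div_iff₀ hZ0 (by positivity)]
    nlinarith
  have b6 : ρ ≤ κ * L / θ / 10 := by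
    rw [div_div, le_div_iff₀ (by positivity)]
    linarith
  have b7 : κ * L / (32 * θ) = κ * L / θ / 32 := by field_simp
  have b8 : 0 < κ * L / θ := by positivity
  have b9 : ρ / R * (8 * (q * ρ) / z) ≤ ρ / R := mul_le_of_le_one_right (by positivity) b3
  have : (T.card : ℝ) ≤ 4 * ρ / R * ((2 * q * ρ + 2 * L * R) / z + 1) := by
    refine hbound.trans ?_
    gcongr
  linarith

/-- The integer points of the box of half-side `R` centred at `c`. -/
def intBox {d : ℕ} (c : Fin d → ℝ) (R : ℝ) : Finset (Fin d → ℤ) :=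
  Fintype.piFinset fun k => Finset.Icc ⌈c k - R⌉ ⌊c k + R⌋

theorem mem_Icc_ceil_floor {c R : ℝ} {z : ℤ} :
    z ∈ Finset.Icc ⌈c - R⌉ ⌊c + R⌋ ↔ |(z : ℝ) - c| ≤ R := by
  rw [Finset.mem_Icc, Int.ceil_le, Int.le_floor, abs_le]
  constructor <;> rintro ⟨h1, h2⟩ <;> constructor <;> linarith

theorem card_Icc_ceil_floor_le (c : ℝ) {R : ℝ} (hR : 1 ≤ R) :
    ((Finset.Icc ⌈c - R⌉ ⌊c + R⌋).card : ℝ) ≤ 3 * R := by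
  have h := card_le_of_injOn_int (Finset.Icc ⌈c - R⌉ ⌊c + R⌋) id (W := 2 * R) (by linarith)
    (Set.injOn_id _) fun a ha b hb => by
      have h1 := abs_le.1 (mem_Icc_ceil_floor.1 ha)
      have h2 := abs_le.1 (mem_Icc_ceil_floor.1 hb)
      simp only [id]
      linarith [h1.2, h2.1]
  linarith

theorem mem_intBox {d : ℕ} {c : Fin d → ℝ} {R : ℝ} {x : Fin d → ℤ} :
    x ∈ intBox c R ↔ ∀ k, |(x k : ℝ) - c k| ≤ R := by
  simp only [intBox, Fintype.mem_piFinset, mem_Icc_ceil_floor]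

theorem card_intBox_le {d : ℕ} (c : Fin d → ℝ) {R : ℝ} (hR : 1 ≤ R) :
    ((intBox c R).card : ℝ) ≤ (3 * R) ^ d := by
  rw [intBox, Fintype.card_piFinset, Nat.cast_prod]
  calc _ ≤ ∏ _k : Fin d, 3 * R :=
        Finset.prod_le_prod (fun _ _ => Nat.cast_nonneg _)
          fun k _ => card_Icc_ceil_floor_le (c k) hR
    _ = _ := by simp

/-- Pigeonhole: a set of integer points in a box has a large section by a coordinate plane. -/
theorem exists_planar_section {d : ℕ} (S : Finset (Fin d → ℤ)) {i j : Fin d} (hij : i ≠ j)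
    {L : ℝ} (hL : 1 ≤ L) (b : Fin d → ℝ) (hS : ∀ y ∈ S, ∀ k, |(y k : ℝ) - b k| ≤ L) :
    ∃ T ⊆ S, (∀ y ∈ T, ∀ y' ∈ T, ∀ k, k ≠ i ∧ k ≠ j → y k = y' k) ∧
      (S.card : ℝ) / (3 * L) ^ (d - 2) ≤ T.card := by
  classical
  rcases S.eq_empty_or_nonempty with rfl | ⟨y₀, hy₀⟩
  · exact ⟨∅, by simp⟩
  set f : (Fin d → ℤ) → Fin d → ℤ := fun y k => if k ≠ i ∧ k ≠ j then y k else 0 with hf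
  set t : Finset (Fin d → ℤ) := Fintype.piFinset fun k =>
    if k ≠ i ∧ k ≠ j then Finset.Icc ⌈b k - L⌉ ⌊b k + L⌋ else {0} with ht
  have hmaps : ∀ y ∈ S, f y ∈ t := by
    intro y hy
    rw [ht, Fintype.mem_piFinset]
    intro k
    by_cases hk : k ≠ i ∧ k ≠ j
    · simp only [hf, if_pos hk]
      exact mem_Icc_ceil_floor.2 (hS y hy k)
    · simp only [hf, if_neg hk, Finset.mem_singleton]
  have hcard : (t.card : ℝ) ≤ (3 * L) ^ (d - 2) := by
    rw [ht, Fintype.card_piFinset, Nat.cast_prod]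
    calc _ ≤ ∏ k : Fin d, (if k ≠ i ∧ k ≠ j then 3 * L else 1) := by
          refine Finset.prod_le_prod (fun _ _ => Nat.cast_nonneg _) fun k _ => ?_
          split_ifs
          · exact card_Icc_ceil_floor_le (b k) hL
          · simp
      _ = (3 * L) ^ (d - 2) := by
          rw [Finset.prod_ite, Finset.prod_const, Finset.prod_const_one, mul_one]
          have : (Finset.univ.filter fun k : Fin d => k ≠ i ∧ k ≠ j) =
              ({i, j} : Finset (Fin d))ᶜ := by
            ext k; simp
          rw [this, Finset.card_compl, Finset.card_pair hij, Fintype.card_fin]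
  have hpos : (0 : ℝ) < (3 * L) ^ (d - 2) := by positivity
  obtain ⟨z, -, hz⟩ := Finset.exists_le_card_fiber_of_nsmul_le_card_of_maps_to hmaps
    ⟨_, hmaps y₀ hy₀⟩ (b := (S.card : ℝ) / (3 * L) ^ (d - 2)) (by
      rw [nsmul_eq_mul, mul_div_assoc', div_le_iff₀ hpos, mul_comm]
      gcongr)
  refine ⟨S.filter fun y => f y = z, Finset.filter_subset _ _, ?_, hz⟩
  intro y hy y' hy' k hk
  have h := congrFun ((Finset.mem_filter.1 hy).2.trans (Finset.mem_filter.1 hy').2.symm) k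
  simpa only [hf, if_pos hk] using h

/-- If a thin slab normal to `x` contains many integer points, and `x j` is large, then each ratio
`x i / x j` is a rational number of small height. -/
theorem exists_ratio_of_card_slab {d : ℕ} (hd : 2 ≤ d) {x : Fin d → ℤ} (S : Finset (Fin d → ℤ))
    {i j : Fin d} (hij : i ≠ j) {b : Fin d → ℝ} {α L θ ρ κ : ℝ} {Q : ℕ}
    (hκ : 0 < κ) (hθ : 2 ≤ θ) (hρ : 1 ≤ ρ) (hL1 : 1 ≤ L) (hL : 4 * θ < κ * L)
    (hρL : 10 * (ρ * θ) ≤ κ * L) (hQ1 : 4 * θ ≤ κ * Q) (hQ2 : 8 * (Q * ρ) ≤ |(x j : ℝ)|)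
    (hZ : 32 * (ρ * θ) ≤ κ * |(x j : ℝ)|) (hZρ : 2 * ρ < |(x j : ℝ)|)
    (hcard : κ * 3 ^ (d - 2) * L ^ (d - 1) / θ ≤ S.card)
    (hb : ∀ y ∈ S, ∀ k, |(y k : ℝ) - b k| ≤ L)
    (hα : ∀ y ∈ S, |∑ k, (x k : ℝ) * y k - α| ≤ ρ) :
    ∃ q p : ℤ, 0 < q ∧ q ≤ Q ∧ q * x i + p * x j = 0 := by
  classical
  obtain ⟨T, hTS, hT, hTcard⟩ := exists_planar_section S hij hL1 b hb
  set g : (Fin d → ℤ) → ℤ × ℤ := fun y => (y i, y j) with hg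
  have hinj : Set.InjOn g T := by
    intro y hy y' hy' h
    have h1 : y i = y' i := congrArg Prod.fst h
    have h2 : y j = y' j := congrArg Prod.snd h
    ext k
    by_cases hki : k = i
    · rw [hki, h1]
    by_cases hkj : k = j
    · rw [hkj, h2]
    exact hT y hy y' hy' k ⟨hki, hkj⟩
  refine exists_mul_add_mul_eq_zero (T.image g) hκ hθ hρ hL hρL hQ1 hQ2 hZ hZρ ?_ ?_ ?_
  · rw [Finset.card_image_of_injOn hinj]
    refine le_trans ?_ hTcard
    rw [le_div_iff₀ (by positivity)]
    refine le_trans (le_of_eq ?_) hcard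
    obtain ⟨m, rfl⟩ : ∃ m, d = m + 2 := ⟨d - 2, by omega⟩
    simp only [Nat.add_sub_cancel, show m + 2 - 1 = m + 1 by omega]
    ring
  · simp only [Finset.mem_image]
    rintro _ ⟨y, hy, rfl⟩ _ ⟨y', hy', rfl⟩
    have h1 := abs_le.1 (hb y (hTS hy) i)
    have h2 := abs_le.1 (hb y' (hTS hy') i)
    simp only [hg]
    push_cast
    rw [abs_le]
    constructor <;> linarith [h1.1, h1.2, h2.1, h2.2]
  · simp only [Finset.mem_image]
    rintro _ ⟨y, hy, rfl⟩ _ ⟨y', hy', rfl⟩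
    have h1 := abs_le.1 (hα y (hTS hy))
    have h2 := abs_le.1 (hα y' (hTS hy'))
    have e : (x i : ℝ) * (y i - y' i) + x j * (y j - y' j) =
        ∑ k, (x k : ℝ) * y k - ∑ k, (x k : ℝ) * y' k := by
      rw [← Finset.sum_sub_distrib, Fintype.sum_eq_add i j hij]
      · ring
      · intro k hk
        rw [hT y hy y' hy' k hk, sub_self]
    simp only [hg]
    push_cast
    rw [e, abs_le]
    constructor <;> linarith [h1.1, h1.2, h2.1, h2.2]

/-- There are few integer points in a slab all of whose coordinates are rational multiples of small
height of a dominant coordinate. -/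
theorem exists_finset_of_ratio (d Q : ℕ) (a : Fin d → ℝ) {L : ℝ} (hL : 1 ≤ L) :
    ∃ G : Finset (Fin d → ℤ), (G.card : ℝ) ≤ d * (3 * L) * (3 * (Q : ℝ) ^ 2) ^ (d - 1) ∧
      ∀ x : Fin d → ℤ, ∀ j, x j ≠ 0 → |(x j : ℝ) - a j| ≤ L → (∀ i, |x i| ≤ |x j|) →
        (∀ i, i ≠ j → ∃ q p : ℤ, 0 < q ∧ q ≤ Q ∧ q * x i + p * x j = 0) → x ∈ G := by
  classical
  set H : ℤ → Finset ℤ := fun z =>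
    (Finset.Icc (1 : ℤ) Q ×ˢ Finset.Icc (-Q : ℤ) Q).image fun w => w.2 * z / w.1 with hH
  set B : Fin d → ℤ → Finset (Fin d → ℤ) := fun j z =>
    Fintype.piFinset fun i => if i = j then {z} else H z with hB
  have hHcard : ∀ z, ((H z).card : ℝ) ≤ 3 * (Q : ℝ) ^ 2 := by
    intro z
    have h : (H z).card ≤ Q * (2 * Q + 1) := by
      refine Finset.card_image_le.trans (le_of_eq ?_)
      rw [Finset.card_product, Int.card_Icc, Int.card_Icc]
      congr 1 <;> omega
    have h' : Q * (2 * Q + 1) ≤ 3 * Q ^ 2 := by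
      rcases Nat.eq_zero_or_pos Q with rfl | hQ
      · simp
      · nlinarith
    exact_mod_cast h.trans h'
  have hBcard : ∀ j z, ((B j z).card : ℝ) ≤ (3 * (Q : ℝ) ^ 2) ^ (d - 1) := by
    intro j z
    simp only [hB]
    rw [Fintype.card_piFinset, Nat.cast_prod, ← Finset.mul_prod_erase _ _ (Finset.mem_univ j)]
    calc _ ≤ (1 : ℝ) * ∏ _i ∈ Finset.univ.erase j, 3 * (Q : ℝ) ^ 2 := by
          rw [if_pos rfl, Finset.card_singleton, Nat.cast_one]
          gcongr with i hi
          rw [if_neg (Finset.ne_of_mem_erase hi)]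
          exact hHcard z
      _ = _ := by simp [Finset.card_erase_of_mem]
  refine ⟨Finset.univ.biUnion fun j => (Finset.Icc ⌈a j - L⌉ ⌊a j + L⌋).biUnion (B j), ?_, ?_⟩
  · calc _ ≤ ((∑ j : Fin d, ∑ z ∈ Finset.Icc ⌈a j - L⌉ ⌊a j + L⌋, (B j z).card : ℕ) : ℝ) := by
          exact_mod_cast Finset.card_biUnion_le.trans
            (Finset.sum_le_sum fun j _ => Finset.card_biUnion_le)
      _ ≤ ∑ _j : Fin d, (3 * L) * (3 * (Q : ℝ) ^ 2) ^ (d - 1) := by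
          rw [Nat.cast_sum]
          refine Finset.sum_le_sum fun j _ => ?_
          rw [Nat.cast_sum]
          refine (Finset.sum_le_sum fun z _ => hBcard j z).trans ?_
          rw [Finset.sum_const, nsmul_eq_mul]
          gcongr
          exact card_Icc_ceil_floor_le (a j) hL
      _ = _ := by simp [mul_assoc]
  · intro x j hx0 hxa hmax hx
    simp only [Finset.mem_biUnion, Finset.mem_univ, true_and]
    refine ⟨j, x j, mem_Icc_ceil_floor.2 hxa, ?_⟩
    simp only [hB, Fintype.mem_piFinset]
    intro i
    split_ifs with hi
    · rw [hi]; exact Finset.mem_singleton_self _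
    · obtain ⟨q, p, hq, hqQ, he⟩ := hx i hi
      have hp : |p| ≤ q := by
        have e : |p| * |x j| = q * |x i| := by
          rw [← abs_mul, show p * x j = -(q * x i) by linarith, abs_neg, abs_mul, abs_of_pos hq]
        have h0 : 0 < |x j| := abs_pos.2 hx0
        refine le_of_mul_le_mul_right ?_ h0
        rw [e]
        exact mul_le_mul_of_nonneg_left (hmax i) hq.le
      have hp' := abs_le.1 hp
      refine Finset.mem_image.2 ⟨(q, -p), ?_, ?_⟩
      · simp only [Finset.mem_product, Finset.mem_Icc]
        omega
      · refine Int.ediv_eq_of_eq_mul_right hq.ne' ?_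
        linarith

theorem three_mul_pow_le (m : ℕ) {M t L : ℝ} (hM : 0 ≤ M) (ht : 0 ≤ t) (htL : t ≤ L) :
    (3 * (M * t)) ^ (m + 3) ≤ (3 * M) ^ (m + 3) * (L ^ (m + 1) * t ^ 2) := by
  rw [← mul_assoc, mul_pow (3 * M), show m + 3 = m + 1 + 2 by omega, pow_add t (m + 1) 2]
  gcongr

theorem ratio_count_le (m : ℕ) {N q E θ ρ L : ℝ} (hN : 0 ≤ N) (hq : 0 ≤ q) (hqE : q ≤ E * θ)
    (hθ : 0 ≤ θ) (hθρ : θ ≤ ρ) (hL : ρ * θ ≤ L) :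
    N * (3 * L) * (3 * q ^ 2) ^ (m + 2) ≤
      N * 3 * (3 * E ^ 2) ^ (m + 2) * (L ^ (m + 1) * ρ ^ 2 * θ ^ 2) := by
  have hρ : 0 ≤ ρ := hθ.trans hθρ
  have hL0 : 0 ≤ L := (mul_nonneg hρ hθ).trans hL
  have hθL : θ * θ ≤ L := (mul_le_mul_of_nonneg_right hθρ hθ).trans hL
  have h1 : (3 * q ^ 2) ^ (m + 2) ≤ (3 * E ^ 2) ^ (m + 2) * (θ * θ) ^ (m + 2) := by
    rw [← mul_pow (3 * E ^ 2), show 3 * E ^ 2 * (θ * θ) = 3 * (E * θ) ^ 2 by ring]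
    gcongr
  have h2 : (θ * θ) ^ (m + 2) ≤ L ^ m * (ρ ^ 2 * θ ^ 2) := by
    rw [pow_add (θ * θ) m 2, show (θ * θ) ^ 2 = θ ^ 2 * θ ^ 2 by ring]
    gcongr
  calc _ ≤ N * (3 * L) * ((3 * E ^ 2) ^ (m + 2) * (L ^ m * (ρ ^ 2 * θ ^ 2))) := by
        gcongr
        exact h1.trans (by gcongr)
    _ = _ := by
        rw [pow_succ L m]
        generalize (3 * E ^ 2) ^ (m + 2) = A
        ring

/-- The integer points of a box which are normal to a rich slab lie in a small finite set. -/
theorem exists_finset_of_slab {d : ℕ} (hd : 3 ≤ d) {c : ℝ} (hc : 0 < c) :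
    ∃ C : ℝ, 3 ≤ C ∧ ∀ L θ ρ : ℝ, C ≤ L → 2 ≤ θ → C * θ ≤ ρ → C * ρ ≤ L → ∀ a : Fin d → ℝ,
      ∃ G : Finset (Fin d → ℤ), (G.card : ℝ) ≤ C * (L ^ (d - 2) * ρ ^ 2 * θ ^ 2) ∧
        ∀ x : Fin d → ℤ, (∀ k, |(x k : ℝ) - a k| ≤ L) →
          ∀ (S : Finset (Fin d → ℤ)) (b : Fin d → ℝ) (α : ℝ), c * L ^ (d - 1) * θ⁻¹ ≤ S.card →
            (∀ y ∈ S, ∀ k, |(y k : ℝ) - b k| ≤ L) →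
            (∀ y ∈ S, |∑ k, (x k : ℝ) * y k - α| ≤ ρ) → x ∈ G := by
  classical
  obtain ⟨m, rfl⟩ : ∃ m, d = m + 3 := ⟨d - 3, by omega⟩
  simp only [show m + 3 - 2 = m + 1 by omega, show m + 3 - 1 = m + 2 by omega]
  set κ : ℝ := c / 3 ^ (m + 1) with hκdef
  have hκ : 0 < κ := by positivity
  set ε : ℝ := min 1 (κ / 10) with hεdef
  have hε : 0 < ε := by positivity
  have hε1 : ε ≤ 1 := min_le_left _ _
  have hεκ : ε ≤ κ / 10 := min_le_right _ _
  set E : ℝ := 4 / κ + 1 with hEdef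
  have hE : 0 < E := by positivity
  set M : ℝ := 8 * E + 32 / κ + 3 with hMdef
  have hκ32 : 0 < 32 / κ := by positivity
  have hM1 : 8 * E ≤ M := by linarith
  have hM2 : 32 ≤ κ * M := by
    have : κ * (32 / κ) = 32 := by field_simp
    nlinarith
  have hM3 : 3 ≤ M := by linarith
  set C₁ : ℝ := 3 ^ (m + 3) / ε ^ 2 with hC₁
  set C₂ : ℝ := (3 * M) ^ (m + 3) with hC₂
  set C₃ : ℝ := ((m + 3 : ℕ) : ℝ) * 3 * (3 * E ^ 2) ^ (m + 2) with hC₃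
  have h₁ : 0 < C₁ := by positivity
  have h₂ : 0 < C₂ := by positivity
  have h₃ : 0 < C₃ := by positivity
  have h₀ : 0 < 5 / κ := by positivity
  clear_value C₁ C₂ C₃ M E ε κ
  refine ⟨3 + 5 / κ + C₁ + C₂ + C₃, by linarith, ?_⟩
  set C := 3 + 5 / κ + C₁ + C₂ + C₃ with hC
  intro L θ ρ hCL hθ hθρ hρL a
  have hL : 1 ≤ L := by linarith
  have hθ0 : 0 < θ := by linarith
  have hθρ' : θ ≤ ρ := (le_mul_of_one_le_left hθ0.le (by linarith)).trans hθρ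
  have hρ : 1 ≤ ρ := by linarith
  have hρ0 : 0 < ρ := by linarith
  have hL0 : 0 < L := by linarith
  have hρθ : 1 ≤ ρ * θ := one_le_mul_of_one_le_of_one_le hρ (by linarith)
  set V := L ^ (m + 1) * ρ ^ 2 * θ ^ 2 with hV
  have hV0 : 0 < V := by positivity
  rcases lt_or_ge (ε * L) (ρ * θ) with hbig | hsmall
  · refine ⟨intBox a L, (card_intBox_le a hL).trans ?_, fun x hx _ _ _ _ _ _ => mem_intBox.2 hx⟩
    calc (3 * L) ^ (m + 3) = C₁ * (L ^ (m + 1) * (ε * L) ^ 2) := by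
          rw [hC₁]; field_simp; ring
      _ ≤ C₁ * (L ^ (m + 1) * (ρ * θ) ^ 2) := by gcongr
      _ = C₁ * V := by rw [hV]; ring
      _ ≤ C * V := by gcongr; linarith
  set Q : ℕ := ⌈4 * θ / κ⌉₊ with hQ
  have hQ1 : 4 * θ ≤ κ * Q := by
    have := Nat.le_ceil (4 * θ / κ)
    rw [div_le_iff₀ hκ] at this
    linarith
  have hQ2 : (Q : ℝ) ≤ E * θ := by
    have h := (Nat.ceil_lt_add_one (show 0 ≤ 4 * θ / κ by positivity)).le
    have e : E * θ = 4 * θ / κ + θ := by rw [hEdef]; ring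
    linarith
  have hρθL : ρ * θ ≤ L := hsmall.trans (mul_le_of_le_one_left hL0.le hε1)
  obtain ⟨G, hGcard, hG⟩ := exists_finset_of_ratio (m + 3) Q a hL
  have hMρθ : 1 ≤ M * (ρ * θ) := one_le_mul_of_one_le_of_one_le (by linarith) hρθ
  have hbox : ((intBox (0 : Fin (m + 3) → ℝ) (M * (ρ * θ))).card : ℝ) ≤ C₂ * V :=
    calc _ ≤ (3 * (M * (ρ * θ))) ^ (m + 3) := card_intBox_le 0 hMρθ
      _ ≤ C₂ * V := by
          rw [hV, mul_assoc (L ^ (m + 1)), ← mul_pow]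
          rw [hC₂]
          exact three_mul_pow_le m (zero_le_three.trans hM3) (zero_le_one.trans hρθ) hρθL
  have hGcard' : (G.card : ℝ) ≤ C₃ * V :=
    calc (G.card : ℝ) ≤ ((m + 3 : ℕ) : ℝ) * (3 * L) * (3 * (Q : ℝ) ^ 2) ^ (m + 2) := hGcard
      _ ≤ C₃ * V := by
          rw [hC₃]
          exact ratio_count_le m (Nat.cast_nonneg _) (Nat.cast_nonneg _) hQ2 hθ0.le hθρ' hρθL
  refine ⟨intBox 0 (M * (ρ * θ)) ∪ G, ?_, ?_⟩
  · calc _ ≤ ((intBox (0 : Fin (m + 3) → ℝ) (M * (ρ * θ))).card : ℝ) + G.card := by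
          exact_mod_cast Finset.card_union_le _ _
      _ ≤ C₂ * V + C₃ * V := add_le_add hbox hGcard'
      _ = (C₂ + C₃) * V := by ring
      _ ≤ C * V := by gcongr; linarith
  intro x hxa S b α hS hSb hSα
  rw [Finset.mem_union, or_iff_not_imp_left]
  intro hx
  obtain ⟨j, -, hj⟩ := Finset.exists_max_image Finset.univ (fun k => |x k|) ⟨0, Finset.mem_univ _⟩
  have hxj : M * (ρ * θ) < |(x j : ℝ)| := by
    by_contra! hle
    refine hx (mem_intBox.2 fun k => ?_)
    have h : |(x k : ℝ)| ≤ |(x j : ℝ)| := by exact_mod_cast hj k (Finset.mem_univ k)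
    simpa using h.trans hle
  refine hG x j ?_ (hxa j) (fun i => hj i (Finset.mem_univ i)) fun i hi => ?_
  · intro h0
    rw [h0, Int.cast_zero, abs_zero] at hxj
    linarith
  · have hρθ0 : 0 ≤ ρ * θ := zero_le_one.trans hρθ
    have hθL : 5 / κ * θ ≤ L :=
      calc 5 / κ * θ ≤ C * θ := mul_le_mul_of_nonneg_right (by linarith) hθ0.le
        _ ≤ ρ := hθρ
        _ ≤ C * ρ := le_mul_of_one_le_left hρ0.le (by linarith)
        _ ≤ L := hρL
    refine exists_ratio_of_card_slab (by omega) S hi hκ hθ hρ hL ?_ ?_ hQ1 ?_ ?_ ?_ ?_ hSb hSα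
    · calc 4 * θ < 5 * θ := by linarith
        _ = κ * (5 / κ * θ) := by field_simp
        _ ≤ κ * L := mul_le_mul_of_nonneg_left hθL hκ.le
    · linarith [mul_le_mul_of_nonneg_right hεκ hL0.le]
    · linarith [mul_le_mul_of_nonneg_right hQ2 hρ0.le, mul_le_mul_of_nonneg_right hM1 hρθ0]
    · linarith [mul_le_mul_of_nonneg_right hM2 hρθ0, mul_le_mul_of_nonneg_left hxj.le hκ.le]
    · linarith [mul_le_mul_of_nonneg_right hM3 hρθ0, mul_le_mul_of_nonneg_left hθ hρ0.le]
    · refine le_trans (le_of_eq ?_) hS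
      simp only [show m + 3 - 2 = m + 1 by omega, show m + 3 - 1 = m + 2 by omega]
      rw [hκdef]
      field_simp

/-- The inclusion of `Fin d → ℤ` in Euclidean space. -/
def latticeMap (d : ℕ) (x : Fin d → ℤ) : EuclideanSpace ℝ (Fin d) :=
  WithLp.toLp 2 fun k => (x k : ℝ)

theorem latticeMap_injective (d : ℕ) : Function.Injective (latticeMap d) := by
  intro x y h
  ext k
  have h' : latticeMap d x k = latticeMap d y k := by rw [h]
  simpa [latticeMap] using h'

theorem exists_latticeMap_eq {d : ℕ} {x : EuclideanSpace ℝ (Fin d)} (hx : x ∈ intLattice d) :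
    ∃ m, latticeMap d m = x := by
  choose m hm using hx
  exact ⟨m, by ext k; simp [latticeMap, hm k]⟩

theorem abs_apply_sub_le_norm {d : ℕ} (x a : EuclideanSpace ℝ (Fin d)) (k : Fin d) :
    |x k - a k| ≤ ‖x - a‖ := by
  simpa using PiLp.norm_apply_le (x - a) k

theorem inner_latticeMap {d : ℕ} (x y : Fin d → ℤ) :
    ⟪latticeMap d x, latticeMap d y⟫ = ∑ k, (x k : ℝ) * y k := by
  simp [latticeMap, PiLp.inner_apply, mul_comm]

theorem statement1 (d : ℕ) (hd : 3 ≤ d) (c : ℝ) (hc : 0 < c) :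
    ∃ C : ℝ, 1 ≤ C ∧
      ∀ L θ ρ : ℝ, C ≤ L → 2 ≤ θ → θ ≤ C⁻¹ * ρ → C * ρ ≤ L →
        ∀ a : EuclideanSpace ℝ (Fin d),
          (Set.ncard {x : EuclideanSpace ℝ (Fin d) |
              x ∈ intLattice d ∧ ‖x - a‖ ≤ L ∧
              ∃ (b : EuclideanSpace ℝ (Fin d)) (α : ℝ),
                c * L ^ ((d : ℝ) - 1) * θ⁻¹ ≤
                  (Set.ncard {y : EuclideanSpace ℝ (Fin d) |
                      y ∈ intLattice d ∧ ‖y - b‖ ≤ L ∧ |⟪x, y⟫ - α| ≤ ρ} : ℝ)} : ℝ) ≤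
            C * (ρ ^ (d : ℝ) + L ^ ((d : ℝ) - 2) * Real.log L ^ C * ρ ^ 2 * θ ^ 2) := by
  classical
  obtain ⟨C, hC3, hC⟩ := exists_finset_of_slab hd hc
  refine ⟨C, by linarith, ?_⟩
  intro L θ ρ hCL hθ hθρ hρL a
  have hC0 : 0 < C := by linarith
  have hL0 : 0 < L := by linarith
  have hθ0 : 0 < θ := by linarith
  have hθρ' : C * θ ≤ ρ := by rwa [← div_eq_inv_mul, le_div_iff₀ hC0, mul_comm] at hθρ
  have hρ0 : 0 < ρ := lt_of_lt_of_le (by positivity) hθρ'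
  have e1 : L ^ ((d : ℝ) - 1) = L ^ (d - 1) := by
    rw [← Real.rpow_natCast, Nat.cast_sub (by omega), Nat.cast_one]
  have e2 : L ^ ((d : ℝ) - 2) = L ^ (d - 2) := by
    rw [← Real.rpow_natCast, Nat.cast_sub (by omega), Nat.cast_ofNat]
  obtain ⟨G, hGcard, hG⟩ := hC L θ ρ hCL hθ hθρ' hρL a
  rw [e1, e2]
  have hlog : 1 ≤ Real.log L ^ C := by
    refine Real.one_le_rpow ?_ hC0.le
    rw [Real.le_log_iff_exp_le hL0]
    linarith [Real.exp_one_lt_three]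
  have hle : C * (L ^ (d - 2) * ρ ^ 2 * θ ^ 2) ≤
      C * (ρ ^ (d : ℝ) + L ^ (d - 2) * Real.log L ^ C * ρ ^ 2 * θ ^ 2) := by
    gcongr
    have h1 : L ^ (d - 2) * ρ ^ 2 * θ ^ 2 ≤ L ^ (d - 2) * Real.log L ^ C * ρ ^ 2 * θ ^ 2 := by
      gcongr
      exact le_mul_of_one_le_right (by positivity) hlog
    have h2 : 0 ≤ ρ ^ (d : ℝ) := by positivity
    linarith
  refine le_trans ?_ (hGcard.trans hle)
  rw [← Finset.card_image_of_injective G (latticeMap_injective d), ← Set.ncard_coe_finset]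
  refine Nat.cast_le.2 (Set.ncard_le_ncard ?_ (Finset.finite_toSet _))
  rintro x ⟨hx, hxa, b, α, hcard⟩
  obtain ⟨m, rfl⟩ := exists_latticeMap_eq hx
  set Y : Set (EuclideanSpace ℝ (Fin d)) :=
    {y | y ∈ intLattice d ∧ ‖y - b‖ ≤ L ∧ |⟪latticeMap d m, y⟫ - α| ≤ ρ} with hY
  have hYfin : Y.Finite := by
    refine Set.finite_of_ncard_pos ?_
    have : (0 : ℝ) < Y.ncard := lt_of_lt_of_le (by positivity) hcard
    exact_mod_cast this
  obtain ⟨S, hS⟩ : ∃ S : Finset (Fin d → ℤ), ∀ y, y ∈ S ↔ latticeMap d y ∈ Y :=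
    ⟨(hYfin.preimage (latticeMap_injective d).injOn).toFinset, fun y => by simp⟩
  have hSY : (S.image (latticeMap d) : Set (EuclideanSpace ℝ (Fin d))) = Y := by
    ext y
    simp only [Finset.coe_image, Set.mem_image, Finset.mem_coe, hS]
    constructor
    · rintro ⟨w, hw, rfl⟩
      exact hw
    · intro hy
      obtain ⟨w, rfl⟩ := exists_latticeMap_eq hy.1
      exact ⟨w, hy, rfl⟩
  rw [Finset.coe_image]
  refine Set.mem_image_of_mem _ (hG m (fun k => ?_) S b α ?_ (fun y hy k => ?_) fun y hy => ?_)
  · exact (abs_apply_sub_le_norm (latticeMap d m) a k).trans hxa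
  · rwa [← hSY, Set.ncard_coe_finset,
      Finset.card_image_of_injective S (latticeMap_injective d)] at hcard
  · exact (abs_apply_sub_le_norm (latticeMap d y) b k).trans ((hS y).1 hy).2.1
  · rw [← inner_latticeMap]
    exact ((hS y).1 hy).2.2
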